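/- arXiv:1102.0642 — 6 statements merged into one kernel-verified Lean document; each statement's English description precedes it below -/
import Mathlib

section
/- Let H be a real Hilbert space and A₁ : H →L H a continuous linear operator with ⟨A₁U, U⟩ ≥ 0 for all U ∈ H. Fix τ > 0 and suppose U, U^n, F ∈ H satisfy U + τ A₁ U = U^n + τ F. Then ‖U‖² ≤ exp(τ)·( ‖U^n‖² + (τ²/(1 − exp(−τ)))·‖F‖² ). -/
open scoped RealInnerProductSpace

/-- A priori estimate (5.11) for the first (implicit lower-triangular) half-step (5.8):
if `U + τ A₁ U = Uⁿ + τ F` with `⟨A₁U, U⟩ ≥ 0`, then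
`‖U‖² ≤ exp τ (‖Uⁿ‖² + (τ²/(1 - exp(-τ))) ‖F‖²)`. -/
theorem stmt_1 {H : Type*} [NormedAddCommGroup H] [InnerProductSpace ℝ H]
    (A₁ : H →L[ℝ] H) (hA₁ : ∀ U : H, 0 ≤ ⟪A₁ U, U⟫)
    (τ : ℝ) (hτ : 0 < τ)
    (U Un F : H) (hscheme : U + τ • A₁ U = Un + τ • F) :
    ‖U‖ ^ 2 ≤ Real.exp τ * (‖Un‖ ^ 2 + (τ ^ 2 / (1 - Real.exp (-τ))) * ‖F‖ ^ 2) := by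
  have hd : 0 < 1 - Real.exp (-τ) := by
    have : Real.exp (-τ) < 1 := Real.exp_lt_one_iff.mpr (by linarith)
    linarith
  have hexp : Real.exp τ * Real.exp (-τ) = 1 := by
    rw [← Real.exp_add, add_neg_cancel, Real.exp_zero]
  have henergy : ‖U‖ ^ 2 + τ * ⟪A₁ U, U⟫ = ⟪Un, U⟫ + τ * ⟪F, U⟫ := by
    have h := congrArg (fun V : H => ⟪V, U⟫) hscheme
    simpa only [inner_add_left, real_inner_smul_left, real_inner_self_eq_norm_sq] using h
  have hUn : 2 * ⟪Un, U⟫ ≤ ‖Un‖ ^ 2 + ‖U‖ ^ 2 := by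
    nlinarith [real_inner_le_norm Un U, sq_nonneg (‖Un‖ - ‖U‖)]
  have hF : 2 * τ * ⟪F, U⟫ ≤
      (1 - Real.exp (-τ)) * ‖U‖ ^ 2 + τ ^ 2 / (1 - Real.exp (-τ)) * ‖F‖ ^ 2 := by
    have hcs : 2 * τ * ⟪F, U⟫ ≤ 2 * τ * (‖F‖ * ‖U‖) :=
      mul_le_mul_of_nonneg_left (real_inner_le_norm F U) (by positivity)
    have hsq : 0 ≤ ((1 - Real.exp (-τ)) * ‖U‖ - τ * ‖F‖) ^ 2 / (1 - Real.exp (-τ)) := by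
      positivity
    have hexpand : ((1 - Real.exp (-τ)) * ‖U‖ - τ * ‖F‖) ^ 2 / (1 - Real.exp (-τ)) =
        (1 - Real.exp (-τ)) * ‖U‖ ^ 2 + τ ^ 2 / (1 - Real.exp (-τ)) * ‖F‖ ^ 2
          - 2 * τ * (‖F‖ * ‖U‖) := by
      have hne := hd.ne'
      field_simp
      ring
    linarith
  have hmain : Real.exp (-τ) * ‖U‖ ^ 2 ≤
      ‖Un‖ ^ 2 + τ ^ 2 / (1 - Real.exp (-τ)) * ‖F‖ ^ 2 := by
    linarith [mul_nonneg hτ.le (hA₁ U)]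
  calc ‖U‖ ^ 2 = Real.exp τ * (Real.exp (-τ) * ‖U‖ ^ 2) := by
        rw [← mul_assoc, hexp, one_mul]
    _ ≤ _ := mul_le_mul_of_nonneg_left hmain (Real.exp_pos τ).le
end

section
/- Let H and Q be real Hilbert spaces, A : H →L H a selfadjoint continuous linear operator, δ > 0 with ⟨A u, u⟩ ≥ δ‖u‖² for all u ∈ H, and B : Q →L H a continuous linear operator. Fix τ > 0. Suppose u^n, f ∈ H, u^{1/2} ∈ H satisfies u^{1/2} + τ A u^{1/2} = u^n + τ f, and p ∈ Q is such that u^{n+1} = u^{1/2} − τ B p satisfies (adjoint B)(u^{n+1}) = 0. Then ‖u^{n+1}‖² ≤ ‖u^n‖² + (τ/(2δ))‖f‖². -/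
open scoped RealInnerProductSpace

/-- Grid analog of the a priori estimate (2.9) for the two-stage splitting scheme (5.1)–(5.3):
viscous stage `u½ + τ A u½ = uⁿ + τ f` followed by the pressure-projection stage
`uⁿ⁺¹ = u½ - τ B p`, `B* uⁿ⁺¹ = 0`, yields `‖uⁿ⁺¹‖² ≤ ‖uⁿ‖² + (τ/(2δ)) ‖f‖²`. -/
theorem stmt_6 {H Q : Type*} [NormedAddCommGroup H] [InnerProductSpace ℝ H] [CompleteSpace H]
    [NormedAddCommGroup Q] [InnerProductSpace ℝ Q] [CompleteSpace Q]
    (A : H →L[ℝ] H) (hAsa : IsSelfAdjoint A)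
    (δ : ℝ) (hδ : 0 < δ) (hA : ∀ u : H, δ * ‖u‖ ^ 2 ≤ ⟪A u, u⟫)
    (B : Q →L[ℝ] H) (τ : ℝ) (hτ : 0 < τ)
    (un f uh u1 : H) (p : Q)
    (hstage1 : uh + τ • A uh = un + τ • f)
    (hstage2 : u1 = uh - τ • B p)
    (hdiv : (ContinuousLinearMap.adjoint B) u1 = 0) :
    ‖u1‖ ^ 2 ≤ ‖un‖ ^ 2 + (τ / (2 * δ)) * ‖f‖ ^ 2 := by
  have horth : ⟪u1, B p⟫ = 0 := by
    rw [← ContinuousLinearMap.adjoint_inner_left, hdiv, inner_zero_left]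
  have hproj : ‖u1‖ ^ 2 ≤ ‖uh‖ ^ 2 := by
    have huh : uh = u1 + τ • B p := by rw [hstage2]; abel
    rw [huh, norm_add_sq_real, inner_smul_right, horth]
    nlinarith [sq_nonneg ‖τ • B p‖]
  have hun : un = uh + τ • (A uh - f) := by
    rw [smul_sub, ← add_sub_assoc, hstage1, add_sub_cancel_right]
  have hexp : ‖uh‖ ^ 2 + 2 * (τ * (⟪A uh, uh⟫ - ⟪f, uh⟫)) ≤ ‖un‖ ^ 2 := by
    rw [hun, norm_add_sq_real, inner_smul_right, inner_sub_right,
      real_inner_comm (A uh) uh, real_inner_comm f uh]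
    nlinarith [sq_nonneg ‖τ • (A uh - f)‖]
  have hyoung : ⟪f, uh⟫ ≤ δ * ‖uh‖ ^ 2 + ‖f‖ ^ 2 / (4 * δ) := by
    have hsq : δ * ‖uh‖ ^ 2 + ‖f‖ ^ 2 / (4 * δ) - ‖f‖ * ‖uh‖
        = (2 * δ * ‖uh‖ - ‖f‖) ^ 2 / (4 * δ) := by
      field_simp
      ring
    have hnonneg : 0 ≤ (2 * δ * ‖uh‖ - ‖f‖) ^ 2 / (4 * δ) := by positivity
    linarith [real_inner_le_norm f uh]
  have hlower : -(‖f‖ ^ 2 / (4 * δ)) ≤ ⟪A uh, uh⟫ - ⟪f, uh⟫ := by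
    linarith [hA uh]
  have hscaled := mul_le_mul_of_nonneg_left hlower hτ.le
  have hcoef : τ / (2 * δ) * ‖f‖ ^ 2 = 2 * (τ * (‖f‖ ^ 2 / (4 * δ))) := by
    field_simp
    ring
  rw [hcoef]
  linarith
end

section
/- Let H and Q be real Hilbert spaces, A : H →L H a selfadjoint continuous linear operator, and δ > 0 with ⟨A w, w⟩ ≥ δ‖w‖² for all w ∈ H. Let B : Q →L H be a continuous linear operator, T > 0, f : ℝ → H continuous, u : ℝ → H differentiable, p : ℝ → Q, and v ∈ H. Suppose for all t ∈ [0,T]: u'(t) + A (u t) + B (p t) = f t and (adjoint B)(u t) = 0, with u 0 = v. Then for all t ∈ [0,T]: ‖u t‖² ≤ ‖v‖² + (1/(2δ)) ∫_0^t ‖f θ‖² dθ. -/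
open scoped RealInnerProductSpace

/-- A priori estimate (2.9) for the abstract Cauchy problem (2.6)–(2.8) modeling the unsteady
Stokes system: if `du/dt + A u + B p = f`, `B* u = 0`, `u 0 = v`, with `A = A* ≥ δ E`, then
`‖u t‖² ≤ ‖v‖² + (1/(2δ)) ∫₀ᵗ ‖f θ‖² dθ` on `[0, T]`. -/
theorem stmt_7 {H Q : Type*} [NormedAddCommGroup H] [InnerProductSpace ℝ H] [CompleteSpace H]
    [NormedAddCommGroup Q] [InnerProductSpace ℝ Q] [CompleteSpace Q]
    (A : H →L[ℝ] H) (hAsa : IsSelfAdjoint A)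
    (δ : ℝ) (hδ : 0 < δ) (hA : ∀ w : H, δ * ‖w‖ ^ 2 ≤ ⟪A w, w⟫)
    (B : Q →L[ℝ] H) (T : ℝ) (hT : 0 < T)
    (f : ℝ → H) (hf : Continuous f)
    (u : ℝ → H) (hu : Differentiable ℝ u)
    (p : ℝ → Q) (v : H)
    (heq : ∀ t ∈ Set.Icc (0 : ℝ) T, deriv u t + A (u t) + B (p t) = f t)
    (hdiv : ∀ t ∈ Set.Icc (0 : ℝ) T, (ContinuousLinearMap.adjoint B) (u t) = 0)
    (hinit : u 0 = v) :
    ∀ t ∈ Set.Icc (0 : ℝ) T,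
      ‖u t‖ ^ 2 ≤ ‖v‖ ^ 2 + (1 / (2 * δ)) * ∫ θ in (0 : ℝ)..t, ‖f θ‖ ^ 2 := by
  have henergy : ∀ t ∈ Set.Icc (0 : ℝ) T,
      2 * ⟪u t, deriv u t⟫ ≤ 1 / (2 * δ) * ‖f t‖ ^ 2 := by
    intro t ht
    have hB : ⟪u t, B (p t)⟫ = 0 := by
      rw [← ContinuousLinearMap.adjoint_inner_left, hdiv t ht, inner_zero_left]
    have hu' : deriv u t = f t - A (u t) - B (p t) := by rw [← heq t ht]; abel
    have hAu := hA (u t)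
    rw [real_inner_comm] at hAu
    have hCS := real_inner_le_norm (u t) (f t)
    have hyoung : 2 * (‖u t‖ * ‖f t‖) - 2 * (δ * ‖u t‖ ^ 2) ≤ 1 / (2 * δ) * ‖f t‖ ^ 2 := by
      have hsq : 1 / (2 * δ) * ‖f t‖ ^ 2 - (2 * (‖u t‖ * ‖f t‖) - 2 * (δ * ‖u t‖ ^ 2))
          = 1 / (2 * δ) * (‖f t‖ - 2 * δ * ‖u t‖) ^ 2 := by
        field_simp
        ring
      have : 0 ≤ 1 / (2 * δ) * (‖f t‖ - 2 * δ * ‖u t‖) ^ 2 := by positivity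
      linarith
    rw [hu', inner_sub_right, inner_sub_right, hB]
    linarith
  have hderiv : ∀ t, HasDerivAt
      (fun s => ‖u s‖ ^ 2 - 1 / (2 * δ) * ∫ θ in (0 : ℝ)..s, ‖f θ‖ ^ 2)
      (2 * ⟪u t, deriv u t⟫ - 1 / (2 * δ) * ‖f t‖ ^ 2) t := fun t =>
    (hu t).hasDerivAt.norm_sq.sub
      (((hf.norm.pow 2).integral_hasStrictDerivAt 0 t).hasDerivAt.const_mul _)
  have hanti := antitoneOn_of_deriv_nonpos (convex_Icc (0 : ℝ) T)
    (fun t _ => (hderiv t).continuousAt.continuousWithinAt)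
    (fun t _ => (hderiv t).differentiableAt.differentiableWithinAt)
    (fun t ht => by
      rw [(hderiv t).deriv]
      exact sub_nonpos.2 (henergy t (interior_subset ht)))
  intro t ht
  have hle := hanti (Set.left_mem_Icc.2 hT.le) ht ht.1
  simp only [intervalIntegral.integral_same, mul_zero, sub_zero, hinit] at hle
  linarith
end

section
/- Let H and Q be real Hilbert spaces, m ≥ 1, A : H →L H selfadjoint with ⟨A w, w⟩ ≥ 0 for all w, χ_α : H →L H selfadjoint operators for α = 1,…,m, and B : Q →L H a continuous linear operator. Let T > 0, f : ℝ → H continuous, p : ℝ → Q, and let u_α : ℝ → H be differentiable for each α. Suppose for all t ∈ [0,T] and all α: u_α'(t) + χ_α ∘ A (Σ_{β=1}^m χ_β (u_β t)) + χ_α (B (p t)) = χ_α (f t), and Σ_{α=1}^m (adjoint B)(χ_α (u_α t)) = 0. Then for all t ∈ [0,T]: Σ_{α=1}^m ‖u_α t‖² ≤ exp(t)·Σ_{α=1}^m ‖u_α 0‖² + ∫_0^t exp(t−θ)·( Σ_{α=1}^m ‖χ_α (f θ)‖² ) dθ. -/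
open scoped RealInnerProductSpace BigOperators

/-- Gronwall's inequality in integral form for `E' ≤ E + g` with continuous `g`. -/
theorem le_exp_mul_add_integral_of_deriv_le {E E' g : ℝ → ℝ} {T : ℝ}
    (hg : Continuous g) (hE : ∀ t, HasDerivAt E (E' t) t)
    (hle : ∀ t ∈ Set.Icc (0 : ℝ) T, E' t ≤ E t + g t) {t : ℝ} (ht : t ∈ Set.Icc (0 : ℝ) T) :
    E t ≤ Real.exp t * E 0 + ∫ θ in (0 : ℝ)..t, Real.exp (t - θ) * g θ := by
  have hc : Continuous fun θ : ℝ => Real.exp (-θ) * g θ := by fun_prop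
  have hF : ∀ s, HasDerivAt
      (fun s => Real.exp (-s) * E s - ∫ θ in (0 : ℝ)..s, Real.exp (-θ) * g θ)
      (Real.exp (-s) * (E' s - E s - g s)) s := by
    intro s
    refine (((hasDerivAt_neg s).exp.fun_mul (hE s)).fun_sub
      (hc.integral_hasStrictDerivAt 0 s).hasDerivAt).congr_deriv ?_
    ring
  have hanti : AntitoneOn
      (fun s => Real.exp (-s) * E s - ∫ θ in (0 : ℝ)..s, Real.exp (-θ) * g θ)
      (Set.Icc 0 T) := by
    refine antitoneOn_of_deriv_nonpos (convex_Icc 0 T)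
      (fun s _ => (hF s).continuousAt.continuousWithinAt)
      (fun s _ => (hF s).differentiableAt.differentiableWithinAt) fun s hs => ?_
    rw [(hF s).deriv]
    have := hle s (interior_subset hs)
    exact mul_nonpos_of_nonneg_of_nonpos (Real.exp_pos _).le (by linarith)
  have h := hanti (Set.left_mem_Icc.2 (ht.1.trans ht.2)) ht ht.1
  simp only [neg_zero, Real.exp_zero, one_mul, intervalIntegral.integral_same, sub_zero] at h
  have hint : ∫ θ in (0 : ℝ)..t, Real.exp (t - θ) * g θ =
      Real.exp t * ∫ θ in (0 : ℝ)..t, Real.exp (-θ) * g θ := by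
    rw [← intervalIntegral.integral_const_mul]
    refine intervalIntegral.integral_congr fun θ _ => ?_
    simp only [sub_eq_add_neg, Real.exp_add, mul_assoc]
  have hmul := mul_le_mul_of_nonneg_left h (Real.exp_pos t).le
  rw [mul_sub, ← mul_assoc, ← Real.exp_add, add_neg_cancel, Real.exp_zero, one_mul] at hmul
  rw [hint]
  linarith

/-- Energy inequality at a fixed time: `v` plays the role of the time derivative of `u`. -/
theorem two_mul_sum_inner_le_of_decomposed_eq {H Q ι : Type*} [Fintype ι]
    [NormedAddCommGroup H] [InnerProductSpace ℝ H] [CompleteSpace H]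
    [NormedAddCommGroup Q] [InnerProductSpace ℝ Q] [CompleteSpace Q]
    {A : H →L[ℝ] H} (hA : ∀ w : H, 0 ≤ ⟪A w, w⟫)
    {χ : ι → H →L[ℝ] H} (hχ : ∀ α, IsSelfAdjoint (χ α)) {B : Q →L[ℝ] H}
    {f : H} {p : Q} {u v : ι → H}
    (heq : ∀ α, v α + χ α (A (∑ β, χ β (u β))) + χ α (B p) = χ α f)
    (hdiv : ∑ α, ContinuousLinearMap.adjoint B (χ α (u α)) = 0) :
    ∑ α, 2 * ⟪u α, v α⟫ ≤ ∑ α, ‖u α‖ ^ 2 + ∑ α, ‖χ α f‖ ^ 2 := by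
  have hsym : ∀ α (x y : H), ⟪x, χ α y⟫ = ⟪χ α x, y⟫ :=
    fun α x y => ((hχ α).isSymmetric x y).symm
  set w := ∑ β, χ β (u β) with hw
  have hv : ∀ α, ⟪u α, v α⟫ = ⟪u α, χ α f⟫ - ⟪χ α (u α), A w⟫ - ⟪χ α (u α), B p⟫ := by
    intro α
    rw [← heq α, inner_add_right, inner_add_right, hsym α _ (A w), hsym α _ (B p)]
    ring
  have hAw : 0 ≤ ∑ α, ⟪χ α (u α), A w⟫ := by
    rw [← sum_inner, ← hw, real_inner_comm]
    exact hA w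
  have hBp : ∑ α, ⟪χ α (u α), B p⟫ = 0 := by
    rw [← sum_inner, ← ContinuousLinearMap.adjoint_inner_left, map_sum, hdiv, inner_zero_left]
  have hyoung : ∑ α, 2 * ⟪u α, χ α f⟫ ≤ ∑ α, ‖u α‖ ^ 2 + ∑ α, ‖χ α f‖ ^ 2 := by
    rw [← Finset.sum_add_distrib]
    refine Finset.sum_le_sum fun α _ => ?_
    nlinarith [real_inner_le_norm (u α) (χ α f), sq_nonneg (‖u α‖ - ‖χ α f‖)]
  rw [← Finset.mul_sum] at hyoung ⊢
  simp only [hv, Finset.sum_sub_distrib, hBp]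
  linarith

/-- A priori estimate (4.8) for the decomposed continuous-in-time system (4.5)–(4.7):
`du_α/dt + χ_α A Σ_β χ_β u_β + χ_α B p = χ_α f` with `Σ_α B* χ_α u_α = 0` implies
`Σ_α ‖u_α t‖² ≤ exp t · Σ_α ‖u_α 0‖² + ∫₀ᵗ exp(t-θ) Σ_α ‖χ_α (f θ)‖² dθ` on `[0, T]`. -/
theorem stmt_8 {H Q : Type*} [NormedAddCommGroup H] [InnerProductSpace ℝ H] [CompleteSpace H]
    [NormedAddCommGroup Q] [InnerProductSpace ℝ Q] [CompleteSpace Q]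
    (m : ℕ) (hm : 1 ≤ m)
    (A : H →L[ℝ] H) (hAsa : IsSelfAdjoint A) (hA : ∀ w : H, 0 ≤ ⟪A w, w⟫)
    (χ : Fin m → H →L[ℝ] H) (hχsa : ∀ α, IsSelfAdjoint (χ α))
    (B : Q →L[ℝ] H) (T : ℝ) (hT : 0 < T)
    (f : ℝ → H) (hf : Continuous f)
    (p : ℝ → Q)
    (u : Fin m → ℝ → H) (hu : ∀ α, Differentiable ℝ (u α))
    (heq : ∀ t ∈ Set.Icc (0 : ℝ) T, ∀ α : Fin m,
      deriv (u α) t + (χ α) (A (∑ β : Fin m, (χ β) (u β t))) + (χ α) (B (p t)) = (χ α) (f t))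
    (hdiv : ∀ t ∈ Set.Icc (0 : ℝ) T,
      ∑ α : Fin m, (ContinuousLinearMap.adjoint B) ((χ α) (u α t)) = 0) :
    ∀ t ∈ Set.Icc (0 : ℝ) T,
      ∑ α : Fin m, ‖u α t‖ ^ 2 ≤
        Real.exp t * ∑ α : Fin m, ‖u α 0‖ ^ 2 +
          ∫ θ in (0 : ℝ)..t, Real.exp (t - θ) * ∑ α : Fin m, ‖(χ α) (f θ)‖ ^ 2 := by
  intro t ht
  have hE : ∀ s, HasDerivAt (fun s => ∑ α : Fin m, ‖u α s‖ ^ 2)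
      (∑ α : Fin m, 2 * ⟪u α s, deriv (u α) s⟫) s :=
    fun s => HasDerivAt.fun_sum fun α _ => (hu α s).hasDerivAt.norm_sq
  exact le_exp_mul_add_integral_of_deriv_le (g := fun θ => ∑ α : Fin m, ‖(χ α) (f θ)‖ ^ 2)
    (by fun_prop) hE
    (fun s hs => two_mul_sum_inner_le_of_decomposed_eq hA hχsa (heq s hs) (hdiv s hs)) ht
end

section
/- Let l > 0 and N ≥ 2 be a natural number, and set h = l/N. Let y : Fin (N+1) → ℝ be a grid function with y 0 = 0 and y N = 0. Define the discrete negative Laplacian at interior nodes by (−Δ_h y)_i = (2·y i − y (i−1) − y (i+1))/h² for 1 ≤ i ≤ N−1. Then Σ_{i=1}^{N−1} (−Δ_h y)_i · y i ≥ (4/h²)·sin²(π h/(2 l)) · Σ_{i=1}^{N−1} (y i)². -/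
open scoped BigOperators

/-- Discrete Jacobi (ground-state) inequality: a solution `s` of `s (i + 2) + s i = c * s (i + 1)`
vanishing at `0` and positive on `{1, …, m + 1}` controls the quadratic form of the
three-term recurrence. -/
lemma ground_state_le_sum (c : ℝ) (s y : ℕ → ℝ) (hs0 : s 0 = 0)
    (hrec : ∀ i, s (i + 2) + s i = c * s (i + 1)) (hy0 : y 0 = 0) (m : ℕ)
    (hpos : ∀ i ≤ m, 0 < s (i + 1)) :
    s (m + 2) / s (m + 1) * y (m + 1) ^ 2 - y (m + 1) * y (m + 2) ≤
      ∑ i ∈ Finset.range (m + 1),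
        (c * y (i + 1) ^ 2 - y i * y (i + 1) - y (i + 1) * y (i + 2)) := by
  induction m with
  | zero =>
    have h1 := hpos 0 le_rfl
    have h2 : s 2 / s 1 = c := by
      rw [div_eq_iff h1.ne']
      simpa [hs0] using hrec 0
    simp [h2, hy0]
  | succ m ih =>
    rw [Finset.sum_range_succ]
    have ih' := ih fun i hi => hpos i (by omega)
    have h1 := hpos m (by omega)
    have h2 := hpos (m + 1) le_rfl
    have hc : c = s (m + 3) / s (m + 2) + s (m + 1) / s (m + 2) := by
      rw [← add_div, eq_div_iff h2.ne']
      exact (hrec (m + 1)).symm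
    have hsq : s (m + 2) / s (m + 1) * y (m + 1) ^ 2 - 2 * (y (m + 1) * y (m + 2))
        + s (m + 1) / s (m + 2) * y (m + 2) ^ 2
        = (s (m + 2) * y (m + 1) - s (m + 1) * y (m + 2)) ^ 2 / (s (m + 1) * s (m + 2)) := by
      have h1' := h1.ne'
      have h2' : s (m + 2) ≠ 0 := h2.ne'
      field_simp
      ring
    have hnn : 0 ≤ (s (m + 2) * y (m + 1) - s (m + 1) * y (m + 2)) ^ 2
        / (s (m + 1) * s (m + 2)) := div_nonneg (sq_nonneg _) (mul_pos h1 h2).le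
    have hcy : c * y (m + 2) ^ 2 = s (m + 3) / s (m + 2) * y (m + 2) ^ 2
        + s (m + 1) / s (m + 2) * y (m + 2) ^ 2 := by
      rw [hc, add_mul]
    show s (m + 3) / s (m + 2) * y (m + 2) ^ 2 - y (m + 2) * y (m + 3) ≤
      _ + (c * y (m + 2) ^ 2 - y (m + 1) * y (m + 2) - y (m + 2) * y (m + 3))
    linarith

/-- Summation form of the discrete Dirichlet eigenvalue bound on `m + 2` subintervals. -/
lemma sum_cos_form_nonneg (m : ℕ) (y : ℕ → ℝ) (hy0 : y 0 = 0) (hyN : y (m + 2) = 0) :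
    0 ≤ ∑ i ∈ Finset.range (m + 1),
      (2 * Real.cos (Real.pi / (m + 2)) * y (i + 1) ^ 2
        - y i * y (i + 1) - y (i + 1) * y (i + 2)) := by
  set θ : ℝ := Real.pi / (m + 2) with hθ
  have hm : (0 : ℝ) < m + 2 := by positivity
  have hθpos : 0 < θ := div_pos Real.pi_pos hm
  have hθmul : ((m : ℝ) + 2) * θ = Real.pi := mul_div_cancel₀ _ hm.ne'
  have key := ground_state_le_sum (2 * Real.cos θ) (fun i => Real.sin (i * θ)) y (by simp)
    (fun i => by
      have h1 : ((i + 2 : ℕ) : ℝ) * θ = ((i + 1 : ℕ) : ℝ) * θ + θ := by push_cast; ring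
      have h2 : (i : ℝ) * θ = ((i + 1 : ℕ) : ℝ) * θ - θ := by push_cast; ring
      rw [h1, h2, Real.sin_add, Real.sin_sub]
      ring) hy0 m
    (fun i hi => by
      have hi' : (i : ℝ) ≤ m := by exact_mod_cast hi
      apply Real.sin_pos_of_pos_of_lt_pi
      · positivity
      · rw [← hθmul]
        push_cast
        exact mul_lt_mul_of_pos_right (by linarith) hθpos)
  have hsN : Real.sin (((m + 2 : ℕ) : ℝ) * θ) = 0 := by
    push_cast
    rw [hθmul, Real.sin_pi]
  simpa only [hsN, hyN, zero_div, zero_mul, mul_zero, sub_zero] using key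

/-- 1D ingredient of the lower bound (3.1): on the uniform grid with step `h = l/N` on `[0,l]`,
the quadratic form of the three-point discrete Dirichlet Laplacian on grid functions vanishing
at the endpoints is bounded below by `(4/h²) sin²(πh/(2l))` times the squared grid `L₂` norm. -/
theorem stmt_11 (l : ℝ) (hl : 0 < l) (N : ℕ) (hN : 2 ≤ N)
    (h : ℝ) (hh : h = l / N)
    (y : ℕ → ℝ) (hy0 : y 0 = 0) (hyN : y N = 0) :
    (4 / h ^ 2) * Real.sin (Real.pi * h / (2 * l)) ^ 2 *
        ∑ i ∈ Finset.Icc 1 (N - 1), (y i) ^ 2 ≤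
      ∑ i ∈ Finset.Icc 1 (N - 1),
        ((2 * y i - y (i - 1) - y (i + 1)) / h ^ 2) * y i := by
  obtain ⟨m, rfl⟩ := Nat.exists_eq_add_of_le' hN
  have hIcc (f : ℕ → ℝ) :
      ∑ i ∈ Finset.Icc 1 (m + 2 - 1), f i = ∑ i ∈ Finset.range (m + 1), f (i + 1) := by
    rw [Finset.range_eq_Ico, Finset.sum_Ico_add' f 0 (m + 1) 1]
    rfl
  have hsin : 4 * Real.sin (Real.pi * h / (2 * l)) ^ 2
      = 2 - 2 * Real.cos (Real.pi / (m + 2)) := by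
    have harg : Real.pi / (m + 2) = 2 * (Real.pi * h / (2 * l)) := by
      rw [hh]
      push_cast
      field_simp
    rw [harg, Real.cos_two_mul, Real.cos_sq']
    ring
  have key := div_nonneg (sum_cos_form_nonneg m y hy0 hyN) (sq_nonneg h)
  rw [hIcc, hIcc, div_mul_eq_mul_div, hsin, ← sub_nonneg, Finset.mul_sum,
    ← Finset.sum_sub_distrib]
  rw [Finset.sum_div] at key
  refine key.trans_eq (Finset.sum_congr rfl fun i _ => ?_)
  rw [Nat.add_sub_cancel]
  ring
end

section
/- Let H be a real Hilbert space, m ≥ 1, A : H →L H selfadjoint with ⟨A w, w⟩ ≥ 0 for all w, χ_α : H →L H selfadjoint operators for α = 1,…,m, Q a real Hilbert space, and B : Q →L H a continuous linear operator. Let u_α : ℝ → H be differentiable, p : ℝ → Q, f : ℝ → H, and fix t ∈ ℝ. Suppose for each α: u_α'(t) + χ_α(A(Σ_{β=1}^m χ_β (u_β t))) + χ_α(B (p t)) = χ_α (f t), and Σ_{α=1}^m (adjoint B)(χ_α (u_α t)) = 0. Then at this t, (1/2)·(d/dt) Σ_{α=1}^m ‖u_α t‖² + ⟨A w, w⟩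 = Σ_{α=1}^m ⟨χ_α (f t), u_α t⟩, where w = Σ_{β=1}^m χ_β (u_β t). -/
open scoped RealInnerProductSpace BigOperators

/-- The energy identity for the decomposed system (4.5)–(4.6): multiplying each equation
scalarly by `u_α`, summing over `α`, and using the constraint `Σ_α B* χ_α u_α = 0` gives
`(1/2) d/dt Σ_α ‖u_α‖² + ⟨A w, w⟩ = Σ_α ⟨χ_α f, u_α⟩` with `w = Σ_β χ_β u_β`. -/
theorem stmt_15 {H Q : Type*} [NormedAddCommGroup H] [InnerProductSpace ℝ H] [CompleteSpace H]
    [NormedAddCommGroup Q] [InnerProductSpace ℝ Q] [CompleteSpace Q]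
    (m : ℕ) (hm : 1 ≤ m)
    (A : H →L[ℝ] H) (hAsa : IsSelfAdjoint A) (hA : ∀ w : H, 0 ≤ ⟪A w, w⟫)
    (χ : Fin m → H →L[ℝ] H) (hχsa : ∀ α, IsSelfAdjoint (χ α))
    (B : Q →L[ℝ] H)
    (u : Fin m → ℝ → H) (hu : ∀ α, Differentiable ℝ (u α))
    (p : ℝ → Q) (f : ℝ → H) (t : ℝ)
    (heq : ∀ α : Fin m,
      deriv (u α) t + (χ α) (A (∑ β : Fin m, (χ β) (u β t))) + (χ α) (B (p t)) = (χ α) (f t))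
    (hdiv : ∑ α : Fin m, (ContinuousLinearMap.adjoint B) ((χ α) (u α t)) = 0) :
    (1 / 2 : ℝ) * deriv (fun s : ℝ => ∑ α : Fin m, ‖u α s‖ ^ 2) t +
        ⟪A (∑ β : Fin m, (χ β) (u β t)), ∑ β : Fin m, (χ β) (u β t)⟫ =
      ∑ α : Fin m, ⟪(χ α) (f t), u α t⟫ := by
  have hderiv : HasDerivAt (fun s : ℝ => ∑ α : Fin m, ‖u α s‖ ^ 2)
      (∑ α : Fin m, 2 * ⟪u α t, deriv (u α) t⟫) t :=
    HasDerivAt.fun_sum fun α _ => (hu α t).hasDerivAt.norm_sq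
  have hsymm (α : Fin m) (v w : H) : ⟪(χ α) v, w⟫ = ⟪v, (χ α) w⟫ :=
    (hχsa α).isSymmetric v w
  have hpressure : ∑ α : Fin m, ⟪(χ α) (B (p t)), u α t⟫ = 0 := by
    simp_rw [hsymm, ← ContinuousLinearMap.adjoint_inner_right]
    rw [← inner_sum, hdiv, inner_zero_right]
  have hdissipation : ⟪A (∑ β : Fin m, (χ β) (u β t)), ∑ β : Fin m, (χ β) (u β t)⟫ =
      ∑ α : Fin m, ⟪(χ α) (A (∑ β : Fin m, (χ β) (u β t))), u α t⟫ := by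
    simp_rw [hsymm]
    exact inner_sum _ _ _
  rw [hderiv.deriv, ← Finset.mul_sum, hdissipation]
  simp_rw [← heq, inner_add_left, Finset.sum_add_distrib]
  rw [hpressure]
  simp_rw [real_inner_comm (u _ t) (deriv (u _) t)]
  ring
end
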